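/- arXiv:2312.15739 — 7 statements merged into one kernel-verified Lean document; each statement's English description precedes it below -/
import Mathlib

section
/- Let f : ℝ → ℝ be continuous, F(s) = ∫₀^s f(u) du, and let α > 0 and c > 0 be real constants. Assume condition (F₄): for all real t > 0 and all real τ ≠ 0, [ f(τ)/(|τ|^{2α}·τ) − f(t·τ)/(|t·τ|^{2α}·t·τ) ]·sign(1 − t) + c·|1 − t^{2α}|/(t·|τ|)^{2α} ≥ 0. Then for every real t ≥ 0 and every real v: (1 − t^{2(1+α)})/(2(1+α))·f(v)·v + F(t·v) − F(v) + c/(2(1+α))·[α − (α+1)·t² + t^{2(1+α)}]·v² ≥ 0. -/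
theorem stmt3 (f : ℝ → ℝ) (hf : Continuous f) (F : ℝ → ℝ)
    (hF : ∀ s : ℝ, F s = ∫ u in (0:ℝ)..s, f u)
    (α c : ℝ) (hα : 0 < α) (hc : 0 < c)
    (hF4 : ∀ t : ℝ, 0 < t → ∀ τ : ℝ, τ ≠ 0 →
      0 ≤ (f τ / (|τ| ^ (2 * α) * τ) - f (t * τ) / (|t * τ| ^ (2 * α) * (t * τ)))
            * Real.sign (1 - t)
          + c * |1 - t ^ (2 * α)| / (t * |τ|) ^ (2 * α)) :
    ∀ t : ℝ, 0 ≤ t → ∀ v : ℝ,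
      0 ≤ (1 - t ^ (2 * (1 + α))) / (2 * (1 + α)) * f v * v + F (t * v) - F v
          + c / (2 * (1 + α)) * (α - (α + 1) * t ^ 2 + t ^ (2 * (1 + α))) * v ^ 2 := by
  intro t ht v
  by_cases hv : v = 0
  · subst hv; simp
  set g : ℝ → ℝ := fun t => (1 - t ^ (2 * (1 + α))) / (2 * (1 + α)) * f v * v + F (t * v) - F v
          + c / (2 * (1 + α)) * (α - (α + 1) * t ^ 2 + t ^ (2 * (1 + α))) * v ^ 2 with hg
  have hα1 : (1 + α) ≠ 0 := by positivity
  have hFd : ∀ s, HasDerivAt F (f s) s := by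
    intro s
    have : F = fun s => ∫ u in (0:ℝ)..s, f u := funext hF
    rw [this]
    exact intervalIntegral.integral_hasDerivAt_right (hf.intervalIntegrable _ _)
      hf.stronglyMeasurable.stronglyMeasurableAtFilter hf.continuousAt
  have hd : ∀ s, 0 < s → HasDerivAt g
      (-(s ^ (2 * α) * s * f v * v - f (s * v) * v + c * (1 - s ^ (2 * α)) * s * v ^ 2)) s := by
    intro s hs
    have h1 : HasDerivAt (fun t : ℝ => t ^ (2 * (1 + α)))
        (2 * (1 + α) * (s ^ (2 * α) * s)) s := by
      have := Real.hasDerivAt_rpow_const (x := s) (p := 2 * (1 + α)) (Or.inl hs.ne')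
      convert this using 2
      rw [show 2 * (1 + α) - 1 = 2 * α + 1 by ring, Real.rpow_add hs, Real.rpow_one]
    have h2 : HasDerivAt (fun t : ℝ => F (t * v)) (f (s * v) * v) s := by
      have := (hFd (s * v)).comp s ((hasDerivAt_id s).mul_const v)
      simpa [Function.comp_def] using this
    have h3 : HasDerivAt (fun t : ℝ => t ^ 2) (2 * s) s := by
      simpa using hasDerivAt_pow 2 s
    have h4 := ((((((h1.const_sub 1).div_const (2 * (1 + α))).mul_const (f v)).mul_const v).add
      h2).sub_const (F v)).add
      ((((((h3.const_mul (α + 1)).const_sub α).add h1).const_mul (c / (2 * (1 + α))))).mul_const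
        (v ^ 2))
    refine h4.congr_deriv ?_
    field_simp
    ring
  have hgc : Continuous g := by
    have hFc : Continuous F := continuous_iff_continuousAt.2 fun s => (hFd s).continuousAt
    have hr : Continuous (fun t : ℝ => t ^ (2 * (1 + α))) :=
      Real.continuous_rpow_const (by positivity)
    simp only [hg]
    fun_prop
  have key : ∀ s, 0 < s →
      0 ≤ (s ^ (2 * α) * s * f v * v - f (s * v) * v) * Real.sign (1 - s)
        + c * |1 - s ^ (2 * α)| * s * v ^ 2 := by
    intro s hs
    have h := hF4 s hs v hv
    have hW : 0 < |v| ^ (2 * α) := Real.rpow_pos_of_pos (abs_pos.2 hv) _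
    have hP : 0 < s ^ (2 * α) := Real.rpow_pos_of_pos hs _
    rw [abs_mul, abs_of_pos hs, Real.mul_rpow hs.le (abs_nonneg v)] at h
    have hm : 0 ≤ s ^ (2 * α) * |v| ^ (2 * α) * s * v ^ 2 := by positivity
    have h5 := mul_nonneg hm h
    refine h5.trans_eq ?_
    clear h5 hm h
    generalize s ^ (2 * α) = P at hP ⊢
    generalize |v| ^ (2 * α) = W at hW ⊢
    generalize Real.sign (1 - s) = σ
    generalize |1 - P| = Q
    field_simp
  have hg1 : g 1 = 0 := by
    simp only [hg, Real.one_rpow]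
    ring_nf
  change 0 ≤ g t
  rw [← hg1]
  rcases le_total t 1 with h | h
  · have hanti : AntitoneOn g (Set.Icc 0 1) := by
      refine antitoneOn_of_deriv_nonpos (convex_Icc 0 1) hgc.continuousOn ?_ ?_
      · intro s hs
        rw [interior_Icc] at hs
        exact (hd s hs.1).differentiableAt.differentiableWithinAt
      · intro s hs
        rw [interior_Icc] at hs
        rw [(hd s hs.1).deriv]
        have hk := key s hs.1
        rw [Real.sign_of_pos (by linarith [hs.2]), abs_of_nonneg (by
          linarith [Real.rpow_le_one hs.1.le hs.2.le (by positivity : 0 ≤ 2 * α)])] at hk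
        linarith
    exact hanti ⟨ht, h⟩ ⟨zero_le_one, le_rfl⟩ h
  · have hmono : MonotoneOn g (Set.Ici 1) := by
      refine monotoneOn_of_deriv_nonneg (convex_Ici 1) hgc.continuousOn ?_ ?_
      · intro s hs
        rw [interior_Ici] at hs
        exact (hd s (zero_lt_one.trans hs)).differentiableAt.differentiableWithinAt
      · intro s hs
        rw [interior_Ici] at hs
        have hs1 : 1 < s := hs
        rw [(hd s (by linarith)).deriv]
        have hk := key s (by linarith)
        rw [Real.sign_of_neg (by linarith), abs_of_nonpos (by
          linarith [Real.one_le_rpow hs1.le (by positivity : 0 ≤ 2 * α)])] at hk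
        linarith
    exact hmono (Set.mem_Ici.2 le_rfl) h h
end

section
/- Let f : ℝ → ℝ be continuous, F(s) = ∫₀^s f(u) du, and let α > 0 and c > 0 be real constants. Assume condition (F₄): for all real t > 0 and all real τ ≠ 0, [ f(τ)/(|τ|^{2α}·τ) − f(t·τ)/(|t·τ|^{2α}·t·τ) ]·sign(1 − t) + c·|1 − t^{2α}|/(t·|τ|)^{2α} ≥ 0. Then for every real v: (1/(2(1+α)))·f(v)·v − F(v) + (c·α/(2(1+α)))·v² ≥ 0. -/
theorem stmt4 (f : ℝ → ℝ) (hf : Continuous f) (F : ℝ → ℝ)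
    (hF : ∀ s : ℝ, F s = ∫ u in (0:ℝ)..s, f u)
    (α c : ℝ) (hα : 0 < α) (hc : 0 < c)
    (hF4 : ∀ t : ℝ, 0 < t → ∀ τ : ℝ, τ ≠ 0 →
      0 ≤ (f τ / (|τ| ^ (2 * α) * τ) - f (t * τ) / (|t * τ| ^ (2 * α) * (t * τ)))
            * Real.sign (1 - t)
          + c * |1 - t ^ (2 * α)| / (t * |τ|) ^ (2 * α)) :
    ∀ v : ℝ,
      0 ≤ 1 / (2 * (1 + α)) * f v * v - F v + c * α / (2 * (1 + α)) * v ^ 2 := by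
  intro v
  have h0 : 0 < 1 + α := by linarith
  by_cases hv : v = 0
  · subst hv
    simp [hF]
  have hFv : F v = v * ∫ t in (0:ℝ)..1, f (t * v) := by
    rw [hF, intervalIntegral.mul_integral_comp_mul_right]
    simp
  have hcp : Continuous (fun t : ℝ => t ^ (2 * α + 1)) :=
    Real.continuous_rpow_const (by linarith)
  have hcf : Continuous (fun t : ℝ => f (t * v)) := by fun_prop
  have hpt : ∀ t ∈ Set.Ioo (0:ℝ) 1,
      0 ≤ (f v * v - c * v ^ 2) * t ^ (2 * α + 1) - v * f (t * v) + c * v ^ 2 * t := by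
    intro t ht
    obtain ⟨ht0, ht1⟩ := ht
    have h := hF4 t ht0 v hv
    have hlt : t ^ (2 * α) < 1 := Real.rpow_lt_one ht0.le ht1 (by linarith)
    have hav : 0 < |v| := abs_pos.mpr hv
    rw [Real.sign_of_pos (by linarith), abs_of_pos (sub_pos.mpr hlt), abs_mul,
      abs_of_pos ht0, Real.mul_rpow ht0.le hav.le] at h
    have hA : 0 < t ^ (2 * α) := Real.rpow_pos_of_pos ht0 _
    have hB : 0 < |v| ^ (2 * α) := Real.rpow_pos_of_pos hav _
    rw [Real.rpow_add ht0, Real.rpow_one]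
    generalize t ^ (2 * α) = A at *
    generalize |v| ^ (2 * α) = B at *
    have hv2 : 0 < v ^ 2 := by positivity
    have hm := mul_nonneg h (show 0 ≤ B * A * t * v ^ 2 by positivity)
    refine hm.trans_eq ?_
    field_simp
    ring
  have hint : 0 ≤ ∫ t in (0:ℝ)..1,
      ((f v * v - c * v ^ 2) * t ^ (2 * α + 1) - v * f (t * v) + c * v ^ 2 * t) := by
    have := intervalIntegral.integral_mono_on_of_le_Ioo (μ := MeasureTheory.volume)
      (f := fun _ : ℝ => (0:ℝ)) zero_le_one
      (by simp) (Continuous.intervalIntegrable (by fun_prop) 0 1) hpt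
    simpa using this
  rw [intervalIntegral.integral_add (Continuous.intervalIntegrable (by fun_prop) 0 1)
      (Continuous.intervalIntegrable (by fun_prop) 0 1),
    intervalIntegral.integral_sub (Continuous.intervalIntegrable (by fun_prop) 0 1)
      (Continuous.intervalIntegrable (by fun_prop) 0 1),
    intervalIntegral.integral_const_mul, intervalIntegral.integral_const_mul,
    intervalIntegral.integral_const_mul, ← hFv, integral_id,
    integral_rpow (Or.inl (by linarith)), Real.one_rpow,
    Real.zero_rpow (by linarith)] at hint
  refine hint.trans_eq ?_
  have e : 2 * α + 1 + 1 = 2 * (1 + α) := by ring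
  rw [e]
  field_simp
  ring
end

section
/- Let f : ℝ → ℝ be continuous, F(s) = ∫₀^s f(u) du, and let γ > 0 and p₀ > 0 be real constants. Assume condition (F₄)′: for all real t > 0 and all real τ ≠ 0, [ f(τ)/τ − f(t·τ)/(t·τ) ]·sign(1 − t) − p₀·|τ|^{γ}·|1 − t^{γ}| ≥ 0. Then for every real t ≥ 0 and every real v: (1 − t²)/2·f(v)·v + F(t·v) − F(v) − p₀/(2(γ+2))·[γ − (γ+2)·t² + 2·t^{γ+2}]·|v|^{γ+2} ≥ 0. -/
theorem stmt6 (f : ℝ → ℝ) (hf : Continuous f) (F : ℝ → ℝ)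
    (hF : ∀ s : ℝ, F s = ∫ u in (0:ℝ)..s, f u)
    (γ p₀ : ℝ) (hγ : 0 < γ) (hp₀ : 0 < p₀)
    (hF4' : ∀ t : ℝ, 0 < t → ∀ τ : ℝ, τ ≠ 0 →
      0 ≤ (f τ / τ - f (t * τ) / (t * τ)) * Real.sign (1 - t)
          - p₀ * |τ| ^ γ * |1 - t ^ γ|) :
    ∀ t : ℝ, 0 ≤ t → ∀ v : ℝ,
      0 ≤ (1 - t ^ 2) / 2 * f v * v + F (t * v) - F v
          - p₀ / (2 * (γ + 2)) * (γ - (γ + 2) * t ^ 2 + 2 * t ^ (γ + 2)) * |v| ^ (γ + 2) := by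
  intro t ht v
  by_cases hv : v = 0
  · subst hv
    have : (0:ℝ) ^ (γ + 2) = 0 := Real.zero_rpow (by positivity)
    simp [this]
  have hFd : ∀ x, HasDerivAt F (f x) x := by
    intro x
    have : F = fun s => ∫ u in (0:ℝ)..s, f u := funext hF
    rw [this]
    exact hf.integral_hasStrictDerivAt 0 x |>.hasDerivAt
  set G : ℝ → ℝ := fun t => (1 - t ^ 2) / 2 * f v * v + F (t * v) - F v
          - p₀ / (2 * (γ + 2)) * (γ - (γ + 2) * t ^ 2 + 2 * t ^ (γ + 2)) * |v| ^ (γ + 2) with hG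
  have hG1 : G 1 = 0 := by simp [hG]
  have hd : ∀ s, HasDerivAt G (-s * f v * v + f (s * v) * v
      - p₀ * (-s + s ^ (γ + 1)) * |v| ^ (γ + 2)) s := by
    intro s
    have h1 : HasDerivAt (fun t : ℝ => t ^ 2) (2 * s) s := by
      simpa using hasDerivAt_pow 2 s
    have h2 : HasDerivAt (fun t : ℝ => t ^ (γ + 2)) ((γ + 2) * s ^ (γ + 2 - 1)) s :=
      Real.hasDerivAt_rpow_const (Or.inr (by linarith))
    have h3 : HasDerivAt (fun t : ℝ => F (t * v)) (f (s * v) * v) s := by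
      have := (hFd (s * v)).comp s ((hasDerivAt_id s).mul_const v)
      simpa [Function.comp_def] using this
    have h4 := ((((((h1.const_sub 1).div_const 2).mul_const (f v)).mul_const v).add h3).sub_const
      (F v)).sub (((((h1.const_mul (γ + 2)).const_sub γ).add (h2.const_mul 2)).const_mul
        (p₀ / (2 * (γ + 2)))).mul_const (|v| ^ (γ + 2)))
    refine h4.congr_deriv ?_
    rw [show γ + 2 - 1 = γ + 1 by ring]
    have : γ + 2 ≠ 0 := by positivity
    field_simp
  have hd' : ∀ s, 0 < s → -s * f v * v + f (s * v) * v
      - p₀ * (-s + s ^ (γ + 1)) * |v| ^ (γ + 2) =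
      - (s * v ^ 2) * (f v / v - f (s * v) / (s * v) - p₀ * |v| ^ γ * (1 - s ^ γ)) := by
    intro s hs
    have e1 : s ^ (γ + 1) = s ^ γ * s := by rw [Real.rpow_add hs, Real.rpow_one]
    have e2 : |v| ^ (γ + 2) = |v| ^ γ * v ^ 2 := by
      rw [Real.rpow_add (abs_pos.2 hv), Real.rpow_two, sq_abs]
    rw [e1, e2]
    field_simp
    ring
  have hc : Continuous G := continuous_iff_continuousAt.2 fun s => (hd s).continuousAt
  change 0 ≤ G t
  rw [← hG1]
  rcases le_total t 1 with h | h
  · have : AntitoneOn G (Set.Icc 0 1) := by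
      refine antitoneOn_of_deriv_nonpos (convex_Icc 0 1) hc.continuousOn
        (fun s _ => (hd s).differentiableAt.differentiableWithinAt) ?_
      intro s hs
      rw [interior_Icc] at hs
      rw [(hd s).deriv, hd' s hs.1]
      have h0 := hF4' s hs.1 v hv
      have hle : s ^ γ ≤ 1 := Real.rpow_le_one hs.1.le hs.2.le hγ.le
      rw [Real.sign_of_pos (by linarith [hs.2]), abs_of_nonneg (show 0 ≤ 1 - s ^ γ by linarith), mul_one] at h0
      have : 0 ≤ s * v ^ 2 := mul_nonneg hs.1.le (sq_nonneg v)
      nlinarith [mul_nonneg this h0]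
    exact this ⟨ht, h⟩ ⟨zero_le_one, le_rfl⟩ h
  · have : MonotoneOn G (Set.Ici 1) := by
      refine monotoneOn_of_deriv_nonneg (convex_Ici 1) hc.continuousOn
        (fun s _ => (hd s).differentiableAt.differentiableWithinAt) ?_
      intro s hs
      rw [interior_Ici] at hs
      have hs1 : 1 < s := hs
      have hs0 : 0 < s := by linarith
      rw [(hd s).deriv, hd' s hs0]
      have h0 := hF4' s hs0 v hv
      have hle : 1 ≤ s ^ γ := Real.one_le_rpow hs1.le hγ.le
      rw [Real.sign_of_neg (by linarith), abs_of_nonpos (show 1 - s ^ γ ≤ 0 by linarith)] at h0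
      have : 0 ≤ s * v ^ 2 := mul_nonneg hs0.le (sq_nonneg v)
      nlinarith [mul_nonneg this h0]
    exact this (Set.mem_Ici.2 le_rfl) h h
end

section
/- Let f : ℝ → ℝ be continuous, F(s) = ∫₀^s f(u) du, and let γ > 0 and p₀ > 0 be real constants. Assume condition (F₄)′: for all real t > 0 and all real τ ≠ 0, [ f(τ)/τ − f(t·τ)/(t·τ) ]·sign(1 − t) − p₀·|τ|^{γ}·|1 − t^{γ}| ≥ 0. Then for every real v: (1/2)·f(v)·v − F(v) − (p₀·γ/(2(γ+2)))·|v|^{γ+2} ≥ 0. -/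
theorem stmt7 (f : ℝ → ℝ) (hf : Continuous f) (F : ℝ → ℝ)
    (hF : ∀ s : ℝ, F s = ∫ u in (0:ℝ)..s, f u)
    (γ p₀ : ℝ) (hγ : 0 < γ) (hp₀ : 0 < p₀)
    (hF4' : ∀ t : ℝ, 0 < t → ∀ τ : ℝ, τ ≠ 0 →
      0 ≤ (f τ / τ - f (t * τ) / (t * τ)) * Real.sign (1 - t)
          - p₀ * |τ| ^ γ * |1 - t ^ γ|) :
    ∀ v : ℝ,
      0 ≤ 1 / 2 * f v * v - F v - p₀ * γ / (2 * (γ + 2)) * |v| ^ (γ + 2) := by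
  intro v
  by_cases hv : v = 0
  · subst hv
    rw [hF]
    have : (0:ℝ) ^ (γ + 2) = 0 := Real.zero_rpow (by linarith)
    simp [this]
  have habs : |v| ^ (γ + 2) = |v| ^ γ * v ^ 2 := by
    rw [Real.rpow_add (abs_pos.mpr hv)]
    norm_num
  have hFv : F v = ∫ t in (0:ℝ)..1, v * f (t * v) := by
    rw [hF, intervalIntegral.integral_const_mul]
    simp
  have hpow : Continuous fun t : ℝ => t ^ (γ + 1) :=
    Real.continuous_rpow_const (by linarith)
  have hle : F v ≤ ∫ t in (0:ℝ)..1,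
      ((v * f v - p₀ * (|v| ^ γ * v ^ 2)) * t + p₀ * (|v| ^ γ * v ^ 2) * t ^ (γ + 1)) := by
    rw [hFv]
    apply intervalIntegral.integral_mono_on_of_le_Ioo zero_le_one
    · exact Continuous.intervalIntegrable (by fun_prop) _ _
    · exact Continuous.intervalIntegrable (by fun_prop) _ _
    · intro t ht
      have ht0 : 0 < t := ht.1
      have h := hF4' t ht0 v hv
      rw [Real.sign_of_pos (by linarith [ht.2]), mul_one,
        abs_of_nonneg (a := 1 - t ^ γ) (by linarith [Real.rpow_le_one ht0.le ht.2.le hγ.le])] at h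
      have h2 := mul_nonneg h (by positivity : 0 ≤ t * v ^ 2)
      have e1 : t ^ (γ + 1) = t ^ γ * t := by rw [Real.rpow_add ht0, Real.rpow_one]
      have e2 : (f v / v - f (t * v) / (t * v) - p₀ * |v| ^ γ * (1 - t ^ γ)) * (t * v ^ 2)
          = t * v * f v - v * f (t * v) - p₀ * |v| ^ γ * (1 - t ^ γ) * (t * v ^ 2) := by
        field_simp
      rw [e2] at h2
      rw [e1]
      linarith
  rw [intervalIntegral.integral_add (Continuous.intervalIntegrable (by fun_prop) _ _)
    (Continuous.intervalIntegrable (by fun_prop) _ _),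
    intervalIntegral.integral_const_mul, intervalIntegral.integral_const_mul, integral_id,
    integral_rpow (Or.inl (by linarith)), Real.one_rpow, Real.zero_rpow (by linarith)] at hle
  rw [habs]
  have e3 : p₀ * γ / (2 * (γ + 2)) * (|v| ^ γ * v ^ 2)
      = p₀ * (|v| ^ γ * v ^ 2) * (1 / 2 - (1 - 0) / (γ + 1 + 1)) := by
    have : γ + 2 ≠ 0 := by linarith
    have : γ + 1 + 1 ≠ 0 := by linarith
    field_simp
    ring
  rw [e3]
  linarith
end

section
/- Let E be a real inner product space and let φ : ℝ → ℝ be continuously differentiable with φ(s) ≥ 0 for all s ≥ 0 and φ non-increasing on [0, ∞). Let Φ(x) = ∫₀^x φ(s) ds, and assume that both t ↦ Φ(t²/2) and t ↦ φ(t²/2)·t² are convex functions on ℝ. Then for all y, z ∈ E: φ(‖y‖²/2)·‖y‖² − φ(‖z‖²/2)·‖z‖² ≥ [ φ′(‖z‖²/2)·‖z‖² + 2·φ(‖z‖²/2) ] · ⟨z, y − z⟩. -/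
open scoped RealInnerProductSpace

lemma tangent_aux (h : ℝ → ℝ) (hc : ConvexOn ℝ Set.univ h) (x y d : ℝ) (hd : HasDerivAt h d x) :
    d * (y - x) ≤ h y - h x := by
  rcases lt_trichotomy x y with hxy | rfl | hxy
  · have := hc.le_slope_of_hasDerivAt (Set.mem_univ _) (Set.mem_univ _) hxy hd
    rwa [slope_def_field, le_div_iff₀ (by linarith)] at this
  · simp
  · have := hc.slope_le_of_hasDerivAt (Set.mem_univ _) (Set.mem_univ _) hxy hd
    rw [slope_def_field, div_le_iff₀ (by linarith)] at this
    linarith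

theorem stmt10 {E : Type*} [NormedAddCommGroup E] [InnerProductSpace ℝ E]
    (φ : ℝ → ℝ) (hφ : ContDiff ℝ 1 φ)
    (hpos : ∀ s : ℝ, 0 ≤ s → 0 ≤ φ s)
    (hmono : ∀ s t : ℝ, 0 ≤ s → s ≤ t → φ t ≤ φ s)
    (Φ : ℝ → ℝ) (hΦ : ∀ x : ℝ, Φ x = ∫ s in (0:ℝ)..x, φ s)
    (hconv1 : ConvexOn ℝ Set.univ (fun t : ℝ => Φ (t ^ 2 / 2)))
    (hconv2 : ConvexOn ℝ Set.univ (fun t : ℝ => φ (t ^ 2 / 2) * t ^ 2)) :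
    ∀ y z : E,
      (deriv φ (‖z‖ ^ 2 / 2) * ‖z‖ ^ 2 + 2 * φ (‖z‖ ^ 2 / 2)) * ⟪z, y - z⟫
        ≤ φ (‖y‖ ^ 2 / 2) * ‖y‖ ^ 2 - φ (‖z‖ ^ 2 / 2) * ‖z‖ ^ 2 := by
  intro y z
  have nn : ∀ t : ℝ, 0 ≤ φ (t ^ 2 / 2) * t ^ 2 := fun t =>
    mul_nonneg (hpos _ (by positivity)) (by positivity)
  rcases eq_or_ne z 0 with rfl | hz
  · simpa using nn ‖y‖
  have hzp : 0 < ‖z‖ := norm_pos_iff.mpr hz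
  have hin : ⟪z, y - z⟫ ≤ ‖z‖ * (‖y‖ - ‖z‖) := by
    rw [inner_sub_right, real_inner_self_eq_norm_sq]
    nlinarith [real_inner_le_norm z y]
  have hd : ∀ t : ℝ, HasDerivAt (fun t : ℝ => φ (t ^ 2 / 2) * t ^ 2)
      ((deriv φ (t ^ 2 / 2) * t ^ 2 + 2 * φ (t ^ 2 / 2)) * t) t := by
    intro t
    have h1 : HasDerivAt (fun t : ℝ => t ^ 2) (2 * t) t := by
      simpa using hasDerivAt_pow 2 t
    have h2 : HasDerivAt φ (deriv φ (t ^ 2 / 2)) (t ^ 2 / 2) :=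
      ((hφ.differentiable (by norm_num)) _).hasDerivAt
    have h4 : HasDerivAt (fun t : ℝ => φ (t ^ 2 / 2)) (deriv φ (t ^ 2 / 2) * (2 * t / 2)) t :=
      HasDerivAt.comp t h2 (h1.div_const 2)
    have h3 : HasDerivAt (fun t : ℝ => φ (t ^ 2 / 2) * t ^ 2)
      (deriv φ (t ^ 2 / 2) * (2 * t / 2) * t ^ 2 + φ (t ^ 2 / 2) * (2 * t)) t := h4.mul h1
    have e : (deriv φ (t ^ 2 / 2) * t ^ 2 + 2 * φ (t ^ 2 / 2)) * t =
      deriv φ (t ^ 2 / 2) * (2 * t / 2) * t ^ 2 + φ (t ^ 2 / 2) * (2 * t) := by ring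
    rw [e]
    exact h3
  have t1 := tangent_aux _ hconv2 ‖z‖ ‖y‖ _ (hd ‖z‖)
  have t0 := tangent_aux _ hconv2 ‖z‖ 0 _ (hd ‖z‖)
  have hz0 := nn ‖z‖
  set C := deriv φ (‖z‖ ^ 2 / 2) * ‖z‖ ^ 2 + 2 * φ (‖z‖ ^ 2 / 2) with hC
  have hCn : 0 ≤ C := by
    have : 0 ≤ C * ‖z‖ ^ 2 := by nlinarith
    exact nonneg_of_mul_nonneg_left this (by positivity)
  have := mul_le_mul_of_nonneg_left hin hCn
  linarith
end

section
/- Let E be a real inner product space, α ≥ 0 a real constant, and let φ : ℝ → ℝ be continuously differentiable with φ(s) ≥ 0 for all s ≥ 0 and φ non-increasing on [0, ∞). Let Φ(x) = ∫₀^x φ(s) ds, and assume that t ↦ Φ(t²/2) − (1/(2(1+α)))·φ(t²/2)·t² is convex on ℝ. Then for all y, z ∈ E: [ Φ(‖y‖²/2) − (1/(2(1+α)))·φ(‖y‖²/2)·‖y‖² ] − [ Φ(‖z‖²/2) − (1/(2(1+α)))·φ(‖z‖²/2)·‖z‖² ] ≥ [ (α/(1+α))·φ(‖z‖²/2) − (1/(2(1+α)))·φ′(‖z‖²/2)·‖z‖²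 ] · ⟨z, y − z⟩. -/
open scoped RealInnerProductSpace

theorem stmt11 {E : Type*} [NormedAddCommGroup E] [InnerProductSpace ℝ E]
    (α : ℝ) (hα : 0 ≤ α)
    (φ : ℝ → ℝ) (hφ : ContDiff ℝ 1 φ)
    (hpos : ∀ s : ℝ, 0 ≤ s → 0 ≤ φ s)
    (hmono : ∀ s t : ℝ, 0 ≤ s → s ≤ t → φ t ≤ φ s)
    (Φ : ℝ → ℝ) (hΦ : ∀ x : ℝ, Φ x = ∫ s in (0:ℝ)..x, φ s)
    (hconv : ConvexOn ℝ Set.univ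
      (fun t : ℝ => Φ (t ^ 2 / 2) - 1 / (2 * (1 + α)) * (φ (t ^ 2 / 2) * t ^ 2))) :
    ∀ y z : E,
      (α / (1 + α) * φ (‖z‖ ^ 2 / 2)
          - 1 / (2 * (1 + α)) * deriv φ (‖z‖ ^ 2 / 2) * ‖z‖ ^ 2) * ⟪z, y - z⟫
        ≤ (Φ (‖y‖ ^ 2 / 2) - 1 / (2 * (1 + α)) * (φ (‖y‖ ^ 2 / 2) * ‖y‖ ^ 2))
          - (Φ (‖z‖ ^ 2 / 2) - 1 / (2 * (1 + α)) * (φ (‖z‖ ^ 2 / 2) * ‖z‖ ^ 2)) := by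
  intro y z
  have hα1 : (1 + α) ≠ 0 := by positivity
  set g : ℝ → ℝ := fun t : ℝ => Φ (t ^ 2 / 2) - 1 / (2 * (1 + α)) * (φ (t ^ 2 / 2) * t ^ 2) with hg
  have hΦd : ∀ x, HasDerivAt Φ (φ x) x := by
    intro x
    have h1 : Φ = fun x => ∫ s in (0:ℝ)..x, φ s := funext hΦ
    rw [h1]
    exact hφ.continuous.integral_hasStrictDerivAt 0 x |>.hasDerivAt
  have hφd : ∀ x, HasDerivAt φ (deriv φ x) x := fun x =>
    (hφ.differentiable (by norm_num) x).hasDerivAt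
  set a := ‖z‖ with ha
  set b := ‖y‖ with hb
  set C := α / (1 + α) * φ (a ^ 2 / 2) - 1 / (2 * (1 + α)) * deriv φ (a ^ 2 / 2) * a ^ 2 with hC
  have hgd : HasDerivAt g (C * a) a := by
    have hsq : HasDerivAt (fun t : ℝ => t ^ 2) (2 * a) a := by
      simpa using hasDerivAt_pow 2 a
    have hq : HasDerivAt (fun t : ℝ => t ^ 2 / 2) a a := by
      exact (hsq.div_const 2).congr_deriv (by ring)
    have h1 : HasDerivAt (fun t : ℝ => Φ (t ^ 2 / 2)) (φ (a ^ 2 / 2) * a) a :=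
      HasDerivAt.comp a (hΦd (a ^ 2 / 2)) hq
    have h2 : HasDerivAt (fun t : ℝ => φ (t ^ 2 / 2)) (deriv φ (a ^ 2 / 2) * a) a :=
      HasDerivAt.comp a (hφd (a ^ 2 / 2)) hq
    have h3 := h1.sub ((h2.mul hsq).const_mul (1 / (2 * (1 + α))))
    refine HasDerivAt.congr_deriv h3 ?_
    rw [hC]
    field_simp
    ring
  have hd : deriv φ (a ^ 2 / 2) ≤ 0 := by
    have hx : (0:ℝ) ≤ a ^ 2 / 2 := by positivity
    have hanti : AntitoneOn φ (Set.Ici 0) := fun s hs t _ hst => hmono s t hs hst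
    have := hanti.derivWithin_nonpos (x := a ^ 2 / 2)
    rwa [(hφd (a ^ 2 / 2)).hasDerivWithinAt.derivWithin (uniqueDiffOn_Ici 0 _ hx)] at this
  have hC0 : 0 ≤ C := by
    have h1 : 0 ≤ α / (1 + α) * φ (a ^ 2 / 2) := mul_nonneg (by positivity) (hpos _ (by positivity))
    have h2 : 0 ≤ 1 / (2 * (1 + α)) * (-deriv φ (a ^ 2 / 2)) * a ^ 2 :=
      mul_nonneg (mul_nonneg (by positivity) (by linarith)) (by positivity)
    rw [hC]
    linarith
  have htan : C * a * (b - a) ≤ g b - g a := by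
    rcases lt_trichotomy a b with h | h | h
    · have := hconv.le_slope_of_hasDerivAt (Set.mem_univ a) (Set.mem_univ b) h hgd
      rw [slope_def_field, le_div_iff₀ (by linarith)] at this
      exact this
    · simp [h]
    · have := hconv.slope_le_of_hasDerivAt (Set.mem_univ b) (Set.mem_univ a) h hgd
      rw [slope_def_field, div_le_iff₀ (by linarith)] at this
      linarith
  have hin : ⟪z, y - z⟫ ≤ a * (b - a) := by
    rw [inner_sub_right, real_inner_self_eq_norm_sq]
    have := real_inner_le_norm z y
    nlinarith
  calc C * ⟪z, y - z⟫ ≤ C * (a * (b - a)) := mul_le_mul_of_nonneg_left hin hC0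
    _ = C * a * (b - a) := by ring
    _ ≤ g b - g a := htan
end

section
/- Let K > 0 and β ∈ [0, 2/5] be real constants, define φ(s) = K + (1+s)^{−β} for s ≥ 0 and Φ(x) = ∫₀^x φ(s) ds for x ≥ 0. Then: (i) K ≤ φ(s) ≤ K + 1 for all s ≥ 0; (ii) φ is non-increasing on [0, ∞); (iii) the function s ↦ Φ(s²) is convex on ℝ; (iv) the derivative of s ↦ s·φ(s) satisfies |(s·φ(s))′| ≤ K + 1 for all s ≥ 0; (v) the function t ↦ φ(t²/2)·t² is convex on ℝ; (vi) for every real α ≥ 0, the function t ↦ Φ(t²/2) − (1/(2(1+α)))·φ(t²/2)·t² is convex on ℝ. -/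
theorem aux_convex (f d1 d2 : ℝ → ℝ) (h1 : ∀ x, HasDerivAt f (d1 x) x)
    (h2 : ∀ x, HasDerivAt d1 (d2 x) x) (h3 : ∀ x, 0 ≤ d2 x) : ConvexOn ℝ Set.univ f := by
  have e1 : deriv f = d1 := funext fun x => (h1 x).deriv
  have e2 : deriv d1 = d2 := funext fun x => (h2 x).deriv
  refine convexOn_univ_of_deriv2_nonneg (fun x => (h1 x).differentiableAt) ?_ ?_
  · rw [e1]; exact fun x => (h2 x).differentiableAt
  · intro x
    simp only [Function.iterate_succ, Function.iterate_zero, Function.comp, id, e1, e2]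
    exact h3 x

theorem aux_pow (a p t : ℝ) (ha : 0 ≤ a) :
    HasDerivAt (fun t : ℝ => (1 + a * t ^ 2) ^ p)
      (2 * a * t * p * (1 + a * t ^ 2) ^ (p - 1)) t := by
  have h : HasDerivAt (fun t : ℝ => 1 + a * t ^ 2) (2 * a * t) t := by
    have := ((hasDerivAt_pow 2 t).const_mul a).const_add 1
    exact this.congr_deriv (by simp; ring)
  exact h.rpow_const (Or.inl (by positivity))

theorem aux_red (u β : ℝ) (hu : 0 < u) :
    u ^ (-β - 1) = u ^ (-β - 1 - 1) * u ∧ u ^ (-β) = u ^ (-β - 1 - 1) * u ^ 2 := by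
  have h1 : u ^ (-β - 1) = u ^ (-β - 1 - 1) * u := by
    rw [Real.rpow_sub_one hu.ne' (-β - 1)]; field_simp
  have h2 : u ^ (-β) = u ^ (-β - 1) * u := by
    rw [Real.rpow_sub_one hu.ne' (-β)]; field_simp
  refine ⟨h1, ?_⟩
  rw [h2, h1]; ring

theorem stmt14 (K β : ℝ) (hK : 0 < K) (hβ : β ∈ Set.Icc (0:ℝ) (2/5))
    (φ : ℝ → ℝ) (hφ : ∀ s : ℝ, φ s = K + (1 + s) ^ (-β))
    (Φ : ℝ → ℝ) (hΦ : ∀ x : ℝ, Φ x = ∫ s in (0:ℝ)..x, φ s) :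
    (∀ s : ℝ, 0 ≤ s → K ≤ φ s ∧ φ s ≤ K + 1) ∧
    (∀ s t : ℝ, 0 ≤ s → s ≤ t → φ t ≤ φ s) ∧
    ConvexOn ℝ Set.univ (fun s : ℝ => Φ (s ^ 2)) ∧
    (∀ s : ℝ, 0 ≤ s → |deriv (fun s : ℝ => s * φ s) s| ≤ K + 1) ∧
    ConvexOn ℝ Set.univ (fun t : ℝ => φ (t ^ 2 / 2) * t ^ 2) ∧
    (∀ α : ℝ, 0 ≤ α → ConvexOn ℝ Set.univ
      (fun t : ℝ => Φ (t ^ 2 / 2) - 1 / (2 * (1 + α)) * (φ (t ^ 2 / 2) * t ^ 2))) := by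
  obtain ⟨hb0, hb1⟩ := hβ
  have hφe : φ = fun s => K + (1 + s) ^ (-β) := funext hφ
  have hle1 : ∀ s : ℝ, 0 ≤ s → (1 + s) ^ (-β) ≤ 1 := fun s hs =>
    Real.rpow_le_one_of_one_le_of_nonpos (by linarith) (by linarith)
  have hpos : ∀ s p : ℝ, 0 ≤ s → 0 < (1 + s) ^ p := fun s p hs =>
    Real.rpow_pos_of_pos (by linarith) _
  -- derivative of φ
  have hdφ : ∀ s : ℝ, 0 ≤ s → HasDerivAt φ (-β * (1 + s) ^ (-β - 1)) s := by
    intro s hs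
    rw [hφe]
    have h : HasDerivAt (fun s : ℝ => 1 + s) 1 s := (hasDerivAt_id s).const_add 1
    have := (h.rpow_const (p := -β) (Or.inl (by linarith))).const_add K
    exact this.congr_deriv (by ring)
  have hmeas : Measurable φ := by rw [hφe]; fun_prop
  have hdΦ : ∀ x : ℝ, 0 ≤ x → HasDerivAt Φ (φ x) x := by
    intro x hx
    rw [show Φ = fun x => ∫ s in (0:ℝ)..x, φ s from funext hΦ]
    refine intervalIntegral.integral_hasDerivAt_right ?_ ?_ (hdφ x hx).continuousAt
    · apply ContinuousOn.intervalIntegrable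
      intro y hy
      rw [Set.uIcc_of_le hx] at hy
      exact (hdφ y hy.1).continuousAt.continuousWithinAt
    · exact hmeas.stronglyMeasurable.stronglyMeasurableAtFilter
  -- g and its derivatives
  have hP : ∀ a : ℝ, 0 ≤ a → ∀ t, HasDerivAt (fun t : ℝ => K + (1 + a * t ^ 2) ^ (-β))
      (2 * a * t * (-β) * (1 + a * t ^ 2) ^ (-β - 1)) t :=
    fun a ha t => (aux_pow a (-β) t ha).const_add K
  have hsq : ∀ t : ℝ, HasDerivAt (fun t : ℝ => t ^ 2) (2 * t) t := fun t => by
    simpa using hasDerivAt_pow 2 t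
  have hcu : ∀ t : ℝ, HasDerivAt (fun t : ℝ => t ^ 3) (3 * t ^ 2) t := fun t => by
    simpa using hasDerivAt_pow 3 t
  have hF : ∀ a : ℝ, 0 ≤ a → ∀ t, HasDerivAt (fun t : ℝ => Φ (a * t ^ 2))
      ((K + (1 + a * t ^ 2) ^ (-β)) * (2 * a * t)) t := by
    intro a ha t
    have h := (hdΦ (a * t ^ 2) (by positivity)).comp t ((hsq t).const_mul a)
    rw [hφ] at h
    exact h.congr_deriv (by ring)
  have hF2 : ∀ a : ℝ, 0 ≤ a → ∀ t, HasDerivAt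
      (fun t : ℝ => (K + (1 + a * t ^ 2) ^ (-β)) * (2 * a * t))
      (2 * a * t * (-β) * (1 + a * t ^ 2) ^ (-β - 1) * (2 * a * t)
        + (K + (1 + a * t ^ 2) ^ (-β)) * (2 * a)) t := by
    intro a ha t
    have h := (hP a ha t).mul ((hasDerivAt_id t).const_mul (2 * a))
    exact h.congr_deriv (by simp)
  have hG : ∀ t, HasDerivAt (fun t : ℝ => (K + (1 + 1/2 * t ^ 2) ^ (-β)) * t ^ 2)
      ((-β) * ((1 + 1/2 * t ^ 2) ^ (-β - 1) * t ^ 3)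
        + (K + (1 + 1/2 * t ^ 2) ^ (-β)) * (2 * t)) t := by
    intro t
    exact ((hP (1/2) (by norm_num) t).mul (hsq t)).congr_deriv (by ring)
  have hG2 : ∀ t, HasDerivAt (fun t : ℝ => (-β) * ((1 + 1/2 * t ^ 2) ^ (-β - 1) * t ^ 3)
        + (K + (1 + 1/2 * t ^ 2) ^ (-β)) * (2 * t))
      ((-β) * ((2 * (1/2) * t * (-β-1) * (1 + 1/2 * t ^ 2) ^ (-β - 1 - 1)) * t ^ 3
          + (1 + 1/2 * t ^ 2) ^ (-β - 1) * (3 * t ^ 2))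
        + ((2 * (1/2) * t * (-β) * (1 + 1/2 * t ^ 2) ^ (-β - 1)) * (2 * t)
          + (K + (1 + 1/2 * t ^ 2) ^ (-β)) * 2)) t := by
    intro t
    have h1 := ((aux_pow (1/2) (-β-1) t (by norm_num)).mul (hcu t)).const_mul (-β)
    have h2 := (hP (1/2) (by norm_num) t).mul ((hasDerivAt_id t).const_mul 2)
    exact (h1.add h2).congr_deriv (by simp)
  have hG3 : ∀ t : ℝ, 0 ≤ ((-β) * ((2 * (1/2) * t * (-β-1) * (1 + 1/2 * t ^ 2) ^ (-β - 1 - 1)) * t ^ 3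
          + (1 + 1/2 * t ^ 2) ^ (-β - 1) * (3 * t ^ 2))
        + ((2 * (1/2) * t * (-β) * (1 + 1/2 * t ^ 2) ^ (-β - 1)) * (2 * t)
          + (K + (1 + 1/2 * t ^ 2) ^ (-β)) * 2)) := by
    intro t
    obtain ⟨e1, e2⟩ := aux_red (1 + 1/2 * t ^ 2) β (by positivity)
    have hA := hpos (1/2 * t ^ 2) (-β - 1 - 1) (by positivity)
    rw [e1, e2]
    generalize (1 + 1/2 * t ^ 2) ^ (-β - 1 - 1) = A at *
    have hx : 0 ≤ 1/2 * t ^ 2 := by positivity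
    have : 0 ≤ A * ((4 * β ^ 2 - 6 * β + 2) * (1/2 * t ^ 2) ^ 2 + (4 - 10 * β) * (1/2 * t ^ 2) + 2) := by
      have h1 : 0 ≤ 4 * β ^ 2 - 6 * β + 2 := by nlinarith
      have h2 : 0 ≤ 4 - 10 * β := by linarith
      positivity
    linarith
  refine ⟨?_, ?_, ?_, ?_, ?_, ?_⟩
  · intro s hs
    rw [hφ]
    have := hle1 s hs
    have := hpos s (-β) hs
    constructor <;> linarith
  · intro s t hs hst
    rw [hφ, hφ]
    have := Real.rpow_le_rpow_of_nonpos (x := 1 + s) (y := 1 + t) (z := -β) (by linarith)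
      (by linarith) (by linarith)
    linarith
  · have h1 := hF 1 (by norm_num)
    simp only [one_mul] at h1
    have h2 := hF2 1 (by norm_num)
    simp only [one_mul] at h2
    refine aux_convex _ _ _ h1 h2 ?_
    intro t
    obtain ⟨e1, e2⟩ := aux_red (1 + t ^ 2) β (by positivity)
    have hA := hpos (t ^ 2) (-β - 1 - 1) (by positivity)
    rw [e1, e2]
    generalize (1 + t ^ 2) ^ (-β - 1 - 1) = A at *
    have : 0 ≤ A * (1 + t ^ 2) * (2 + (2 - 4 * β) * t ^ 2) := by
      have h2 : 0 ≤ 2 - 4 * β := by linarith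
      positivity
    linarith
  · intro s hs
    have h := (hasDerivAt_id s).mul (hdφ s hs)
    have hd : deriv (fun s : ℝ => s * φ s) s = 1 * φ s + s * (-β * (1 + s) ^ (-β - 1)) := h.deriv
    rw [hd, hφ]
    have h1 := hle1 s hs
    have h2 := hpos s (-β - 1) hs
    have h3 : (1 + s) ^ (-β) = (1 + s) ^ (-β - 1) * (1 + s) := by
      rw [Real.rpow_sub_one (by linarith)]; field_simp
    rw [h3] at h1 ⊢
    generalize (1 + s) ^ (-β - 1) = A at *
    have h4 : 0 ≤ A * (s * β) := by positivity
    have h5 : 0 ≤ A * (1 + s * (1 - β)) := by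
      have : 0 ≤ 1 - β := by linarith
      positivity
    rw [abs_le]
    constructor <;> linarith
  · have e : (fun t : ℝ => φ (t ^ 2 / 2) * t ^ 2)
        = fun t : ℝ => (K + (1 + 1/2 * t ^ 2) ^ (-β)) * t ^ 2 := by
      funext t; rw [hφ, show t ^ 2 / 2 = 1/2 * t ^ 2 by ring]
    rw [e]
    exact aux_convex _ _ _ hG hG2 hG3
  · intro α hα
    have e : (fun t : ℝ => Φ (t ^ 2 / 2) - 1 / (2 * (1 + α)) * (φ (t ^ 2 / 2) * t ^ 2))
        = fun t : ℝ => Φ (1/2 * t ^ 2) - 1 / (2 * (1 + α)) *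
          ((K + (1 + 1/2 * t ^ 2) ^ (-β)) * t ^ 2) := by
      funext t; rw [hφ, show t ^ 2 / 2 = 1/2 * t ^ 2 by ring]
    rw [e]
    have hc : 1 / (2 * (1 + α)) ≤ 1 / 2 := by
      apply one_div_le_one_div_of_le <;> linarith
    generalize 1 / (2 * (1 + α)) = c at *
    refine aux_convex _ _ _ (fun t => (hF (1/2) (by norm_num) t).sub ((hG t).const_mul c))
      (fun t => (hF2 (1/2) (by norm_num) t).sub ((hG2 t).const_mul c)) ?_
    intro t
    have h3 := mul_nonneg (sub_nonneg.2 hc) (hG3 t)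
    obtain ⟨e1, e2⟩ := aux_red (1 + 1/2 * t ^ 2) β (by positivity)
    have hA := hpos (1/2 * t ^ 2) (-β - 1 - 1) (by positivity)
    rw [e1, e2] at h3 ⊢
    generalize (1 + 1/2 * t ^ 2) ^ (-β - 1 - 1) = A at *
    have : 0 ≤ A * (β * t ^ 2 * (3/2 + (1/2 - β) * (1/2 * t ^ 2))) := by
      have h2 : 0 ≤ 1/2 - β := by linarith
      positivity
    linarith
end
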